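/- For any bounded Borel set A in ℝ^d, the Lebesgue volume of A is at most (π^{d/2} / (2^d Γ(d/2+1))) · diam(A)^d, where diam(A) = sup {‖x−y‖ : x,y ∈ A}. -/

import Mathlib

open MeasureTheory

/-- The Steiner symmetrization of `A` with respect to the hyperplane `x i = 0`. -/
def steinerSymm {ι : Type*} [DecidableEq ι] (i : ι) (A : Set (ι → ℝ)) : Set (ι → ℝ) :=
  {x | ENNReal.ofReal (2 * |x i|) < volume {t : ℝ | Function.update x i t ∈ A}}

/-- Two sets of reals with lengths more than `2a` and `2b` have points at distance at least
`a + b`. -/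
lemma exists_add_le_abs_sub {E F : Set ℝ} {a b : ℝ} (ha : 0 ≤ a) (hb : 0 ≤ b)
    (hE : ENNReal.ofReal (2 * a) < volume E) (hF : ENNReal.ofReal (2 * b) < volume F) :
    ∃ e ∈ E, ∃ f ∈ F, a + b ≤ |e - f| := by
  by_contra! h
  obtain ⟨e₀, he₀⟩ : E.Nonempty := nonempty_of_measure_ne_zero (ne_bot_of_gt hE)
  obtain ⟨f₀, hf₀⟩ : F.Nonempty := nonempty_of_measure_ne_zero (ne_bot_of_gt hF)
  have hEa : BddAbove E := ⟨f₀ + (a + b), fun e he => by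
    linarith [(abs_lt.mp (h e he f₀ hf₀)).2]⟩
  have hEb : BddBelow E := ⟨f₀ - (a + b), fun e he => by
    linarith [(abs_lt.mp (h e he f₀ hf₀)).1]⟩
  have hFa : BddAbove F := ⟨e₀ + (a + b), fun f hf => by
    linarith [(abs_lt.mp (h e₀ he₀ f hf)).1]⟩
  have hFb : BddBelow F := ⟨e₀ - (a + b), fun f hf => by
    linarith [(abs_lt.mp (h e₀ he₀ f hf)).2]⟩
  have length_lt {S : Set ℝ} {c : ℝ} (hc : 0 ≤ c) (hS : ENNReal.ofReal (2 * c) < volume S)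
      (hSa : BddAbove S) (hSb : BddBelow S) : 2 * c < sSup S - sInf S := by
    have := hS.trans_le (measure_mono (subset_Icc_csInf_csSup hSb hSa))
    rw [Real.volume_Icc] at this
    exact (ENNReal.ofReal_lt_ofReal_iff_of_nonneg (by positivity)).mp this
  have hE' := length_lt ha hE hEa hEb
  have hF' := length_lt hb hF hFa hFb
  have h₁ : sSup E ≤ sInf F + (a + b) := csSup_le ⟨e₀, he₀⟩ fun e he => by
    have : e - (a + b) ≤ sInf F := le_csInf ⟨f₀, hf₀⟩ fun f hf => by
      linarith [(abs_lt.mp (h e he f hf)).2]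
    linarith
  have h₂ : sSup F ≤ sInf E + (a + b) := csSup_le ⟨f₀, hf₀⟩ fun f hf => by
    have : f - (a + b) ≤ sInf E := le_csInf ⟨e₀, he₀⟩ fun e he => by
      linarith [(abs_lt.mp (h e he f hf)).1]
    linarith
  linarith

lemma volume_setOf_ofReal_two_mul_abs_lt {v : ENNReal} (hv : v ≠ ⊤) :
    volume {t : ℝ | ENNReal.ofReal (2 * |t|) < v} = v := by
  have : {t : ℝ | ENNReal.ofReal (2 * |t|) < v} = Metric.ball 0 (v.toReal / 2) := by
    ext t
    rw [Set.mem_ofPred_eq, ENNReal.ofReal_lt_iff_lt_toReal (by positivity) hv, mem_ball_zero_iff,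
      Real.norm_eq_abs, lt_div_iff₀' two_pos]
  rw [this, Real.volume_ball, mul_div_cancel₀ _ two_ne_zero, ENNReal.ofReal_toReal hv]

section

variable {ι : Type*} [DecidableEq ι]

lemma lmarginal_singleton_indicator_one {A : Set (ι → ℝ)} (hA : MeasurableSet A) (i : ι)
    (x : ι → ℝ) :
    lmarginal (fun _ : ι => (volume : Measure ℝ)) {i} (A.indicator 1) x =
      volume {t : ℝ | Function.update x i t ∈ A} := by
  rw [lmarginal_singleton]
  exact lintegral_indicator_one (measurable_update x hA)

lemma update_neg_mem_steinerSymm {A : Set (ι → ℝ)} (i : ι) {x : ι → ℝ}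
    (hx : x ∈ steinerSymm i A) : Function.update x i (-x i) ∈ steinerSymm i A := by
  simpa [steinerSymm] using hx

lemma update_neg_mem_steinerSymm_of_ne {A : Set (ι → ℝ)} {i j : ι} (hij : j ≠ i)
    (hA : ∀ x ∈ A, Function.update x j (-x j) ∈ A) {x : ι → ℝ}
    (hx : x ∈ steinerSymm i A) : Function.update x j (-x j) ∈ steinerSymm i A := by
  simp only [steinerSymm, Set.mem_ofPred_eq, Function.update_of_ne hij.symm] at hx ⊢
  refine hx.trans_le (measure_mono fun t ht => ?_)
  have := hA _ ht
  rwa [Function.update_of_ne hij, Function.update_comm hij.symm] at this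

lemma measurableSet_steinerSymm {A : Set (ι → ℝ)} (hA : MeasurableSet A) (i : ι) :
    MeasurableSet (steinerSymm i A) := by
  refine measurableSet_lt (by fun_prop) ?_
  simp_rw [← lmarginal_singleton_indicator_one hA]
  exact (measurable_one.indicator hA).lmarginal _

variable [Fintype ι]

lemma volume_section_ne_top {A : Set (ι → ℝ)} {D : ℝ}
    (hD : ∀ x ∈ A, ∀ y ∈ A, ∑ j, (x j - y j) ^ 2 ≤ D ^ 2) (i : ι) (x : ι → ℝ) :
    volume {t : ℝ | Function.update x i t ∈ A} ≠ ⊤ := by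
  refine (Metric.isBounded_iff.mpr ⟨|D|, fun s hs t ht => ?_⟩).measure_lt_top.ne
  rw [Real.dist_eq, ← sq_le_sq]
  refine le_trans ?_ (hD _ hs _ ht)
  simpa using Finset.single_le_sum (f := fun j => (Function.update x i s j -
    Function.update x i t j) ^ 2) (fun j _ => sq_nonneg _) (Finset.mem_univ i)

lemma volume_steinerSymm {A : Set (ι → ℝ)} (hA : MeasurableSet A) {D : ℝ}
    (hD : ∀ x ∈ A, ∀ y ∈ A, ∑ j, (x j - y j) ^ 2 ≤ D ^ 2) (i : ι) :
    volume (steinerSymm i A) = volume A := by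
  have hS := measurableSet_steinerSymm hA i
  rw [← lintegral_indicator_one hS, ← lintegral_indicator_one hA]
  refine lintegral_eq_of_lmarginal_eq {i} (measurable_one.indicator hS)
    (measurable_one.indicator hA) (funext fun x => ?_)
  rw [lmarginal_singleton_indicator_one hS, lmarginal_singleton_indicator_one hA]
  simpa [steinerSymm] using volume_setOf_ofReal_two_mul_abs_lt (volume_section_ne_top hD i x)

lemma sum_sq_sub_le_of_mem_steinerSymm {A : Set (ι → ℝ)} {D : ℝ}
    (hD : ∀ x ∈ A, ∀ y ∈ A, ∑ j, (x j - y j) ^ 2 ≤ D ^ 2) (i : ι) :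
    ∀ x ∈ steinerSymm i A, ∀ y ∈ steinerSymm i A, ∑ j, (x j - y j) ^ 2 ≤ D ^ 2 := by
  intro x hx y hy
  obtain ⟨e, he, f, hf, hef⟩ := exists_add_le_abs_sub (abs_nonneg _) (abs_nonneg _) hx hy
  refine le_trans (Finset.sum_le_sum fun j _ => ?_) (hD _ he _ hf)
  by_cases hj : j = i
  · subst hj
    simpa [sq_le_sq] using (abs_sub _ _).trans hef
  · simp [hj]

/-- Successive Steiner symmetrizations in the coordinates of `s`. -/
lemma exists_symmetric_volume_eq {A : Set (ι → ℝ)} (hA : MeasurableSet A) {D : ℝ}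
    (hD : ∀ x ∈ A, ∀ y ∈ A, ∑ j, (x j - y j) ^ 2 ≤ D ^ 2) (s : Finset ι) :
    ∃ B : Set (ι → ℝ), MeasurableSet B ∧ volume B = volume A ∧
      (∀ x ∈ B, ∀ y ∈ B, ∑ j, (x j - y j) ^ 2 ≤ D ^ 2) ∧
      ∀ j ∈ s, ∀ x ∈ B, Function.update x j (-x j) ∈ B := by
  induction s using Finset.induction_on with
  | empty => exact ⟨A, hA, rfl, hD, by simp⟩
  | insert i s hi ih =>
    obtain ⟨B, hB, hvol, hBD, hsymm⟩ := ih
    refine ⟨steinerSymm i B, measurableSet_steinerSymm hB i,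
      (volume_steinerSymm hB hBD i).trans hvol, sum_sq_sub_le_of_mem_steinerSymm hBD i, ?_⟩
    intro j hj x hx
    by_cases hji : j = i
    · subst hji
      exact update_neg_mem_steinerSymm j hx
    · exact update_neg_mem_steinerSymm_of_ne hji
        (hsymm j ((Finset.mem_insert.mp hj).resolve_left hji)) hx

lemma neg_mem_of_update_neg_mem {B : Set (ι → ℝ)}
    (hB : ∀ j, ∀ x ∈ B, Function.update x j (-x j) ∈ B) {x : ι → ℝ} (hx : x ∈ B) : -x ∈ B := by
  have key (s : Finset ι) : s.piecewise (-x) x ∈ B := by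
    induction s using Finset.induction_on with
    | empty => simpa using hx
    | insert i s hi ih =>
      rw [Finset.piecewise_insert]
      simpa [hi] using hB i _ ih
  simpa using key Finset.univ

lemma volume_le_volume_sum_sq_le {A : Set (ι → ℝ)} (hA : MeasurableSet A) {D : ℝ}
    (hD : ∀ x ∈ A, ∀ y ∈ A, ∑ j, (x j - y j) ^ 2 ≤ D ^ 2) :
    volume A ≤ volume {x : ι → ℝ | ∑ j, x j ^ 2 ≤ (D / 2) ^ 2} := by
  obtain ⟨B, -, hvol, hBD, hsymm⟩ := exists_symmetric_volume_eq hA hD Finset.univ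
  rw [← hvol]
  refine measure_mono fun x hx => ?_
  have h := hBD x hx (-x) (neg_mem_of_update_neg_mem (fun j => hsymm j (Finset.mem_univ j)) hx)
  have h4 : ∑ j, (x j - (-x) j) ^ 2 = 4 * ∑ j, x j ^ 2 := by
    rw [Finset.mul_sum]
    exact Finset.sum_congr rfl fun j _ => by rw [Pi.neg_apply]; ring
  rw [Set.mem_ofPred_eq]
  linarith

/-- A measurable bounded set has at most the volume of a ball of the same diameter. -/
lemma volume_le_volume_closedBall_half_diam {A : Set (EuclideanSpace ℝ ι)}
    (hA : Bornology.IsBounded A) (hmeas : MeasurableSet A) :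
    volume A ≤ volume (Metric.closedBall (0 : EuclideanSpace ℝ ι) (Metric.diam A / 2)) := by
  have hp := EuclideanSpace.volume_preserving_symm_measurableEquiv_toLp ι
  rw [← (hp.symm).measure_preimage hmeas.nullMeasurableSet,
    ← (hp.symm).measure_preimage measurableSet_closedBall.nullMeasurableSet]
  refine (volume_le_volume_sum_sq_le (D := Metric.diam A) ((hp.symm).measurable hmeas) ?_).trans
    (measure_mono fun x hx => ?_)
  · intro x hx y hy
    have := Metric.dist_le_diam_of_mem hA hx hy
    rw [EuclideanSpace.dist_eq, Real.sqrt_le_left Metric.diam_nonneg] at this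
    simpa [Real.dist_eq] using this
  · rw [Set.mem_preimage, mem_closedBall_zero_iff, EuclideanSpace.norm_eq,
      Real.sqrt_le_left (div_nonneg Metric.diam_nonneg zero_le_two)]
    simpa using hx

end

/-- Isodiametric inequality: the Lebesgue volume of a bounded Borel set `A ⊆ ℝ^d` is at most
`π^{d/2} / (2^d Γ(d/2+1)) · diam(A)^d`. -/
theorem stmt_0 (d : ℕ) (A : Set (EuclideanSpace ℝ (Fin d)))
    (hA : Bornology.IsBounded A) (hmeas : MeasurableSet A) :
    (volume A).toReal ≤
      Real.pi ^ ((d : ℝ) / 2) / (2 ^ d * Real.Gamma ((d : ℝ) / 2 + 1)) *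
        Metric.diam A ^ d := by
  refine (ENNReal.toReal_mono Metric.isBounded_closedBall.measure_lt_top.ne
    (volume_le_volume_closedBall_half_diam hA hmeas)).trans_eq ?_
  have hG : 0 < Real.Gamma ((d : ℝ) / 2 + 1) := Real.Gamma_pos_of_pos (by positivity)
  have hpi : √Real.pi ^ d = Real.pi ^ ((d : ℝ) / 2) := by
    rw [Real.sqrt_eq_rpow, ← Real.rpow_natCast, ← Real.rpow_mul Real.pi_pos.le]
    ring_nf
  rcases Nat.eq_zero_or_pos d with rfl | hd
  · have hu : Metric.closedBall (0 : EuclideanSpace ℝ (Fin 0)) (Metric.diam A / 2) = Set.univ := by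
      ext x
      simpa [Subsingleton.elim x 0] using div_nonneg Metric.diam_nonneg zero_le_two
    have hp := EuclideanSpace.volume_preserving_symm_measurableEquiv_toLp (Fin 0)
    rw [hu, ← (hp.symm).measure_preimage MeasurableSet.univ.nullMeasurableSet, Set.preimage_univ,
      volume_pi, Measure.pi_univ]
    simp
  · have : Nonempty (Fin d) := ⟨⟨0, hd⟩⟩
    rw [EuclideanSpace.volume_closedBall, Fintype.card_fin, hpi, ENNReal.toReal_mul,
      ENNReal.toReal_pow, ENNReal.toReal_ofReal (div_nonneg Metric.diam_nonneg zero_le_two),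
      ENNReal.toReal_ofReal (by positivity), div_pow]
    field_simp
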